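/- Distance bound for nondegenerate outer codes (Eq. (18)): In the GCQC setup, if every outer code A_i (1 ≤ i ≤ m) is nondegenerate, then every element of S_𝒞^⊥ ∖ S_𝒞 has symplectic weight at least min{d₁D₁, d₂D₂, …, d_mD_m}; i.e., the minimum distance of the GCQC satisfies 𝒟 ≥ min{d₁D₁, …, d_mD_m}. -/

import Mathlib

open Finset

/-- Pauli operators (up to phase) on `n` qubits, as symplectic vectors. -/
abbrev Pauli (n : ℕ) := Fin n → (ZMod 2) × (ZMod 2)

/-- The outer space `W = (𝔽₂^r × 𝔽₂^r)^N`. -/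
abbrev Outer (r N : ℕ) := Fin N → (Fin r → ZMod 2) × (Fin r → ZMod 2)

/-- `N` blocks of `n` qubits each. -/
abbrev PauliB (n N : ℕ) := Fin N → Pauli n

/-- Elementary symplectic form on one qubit. -/
def B0 : LinearMap.BilinForm (ZMod 2) ((ZMod 2) × (ZMod 2)) :=
  LinearMap.mk₂ (ZMod 2) (fun u v => u.1 * v.2 + v.1 * u.2)
    (fun a b v => by simp; ring)
    (fun c a v => by simp; ring)
    (fun a b v => by simp; ring)
    (fun c a v => by simp; ring)

/-- Sum of a bilinear form over `N` coordinates. -/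
def sumForm {M : Type*} [AddCommGroup M] [Module (ZMod 2) M] (N : ℕ)
    (B : LinearMap.BilinForm (ZMod 2) M) :
    LinearMap.BilinForm (ZMod 2) (Fin N → M) :=
  LinearMap.mk₂ (ZMod 2) (fun u v => ∑ j, B (u j) (v j))
    (fun a b v => by simp [Finset.sum_add_distrib])
    (fun c a v => by simp [Finset.mul_sum])
    (fun a b v => by simp [Finset.sum_add_distrib])
    (fun c a v => by simp [Finset.mul_sum])

/-- Symplectic form on `r`-qubit blocks written as pairs of binary `r`-vectors. -/
def pairForm (r : ℕ) : LinearMap.BilinForm (ZMod 2) ((Fin r → ZMod 2) × (Fin r → ZMod 2)) :=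
  LinearMap.mk₂ (ZMod 2) (fun u v => ∑ ℓ, (u.1 ℓ * v.2 ℓ + v.1 ℓ * u.2 ℓ))
    (fun a b v => by rw [← Finset.sum_add_distrib]; refine Finset.sum_congr rfl fun ℓ _ => by simp; ring)
    (fun c a v => by rw [smul_eq_mul, Finset.mul_sum]; refine Finset.sum_congr rfl fun ℓ _ => by simp; ring)
    (fun a b v => by rw [← Finset.sum_add_distrib]; refine Finset.sum_congr rfl fun ℓ _ => by simp; ring)
    (fun c a v => by rw [smul_eq_mul, Finset.mul_sum]; refine Finset.sum_congr rfl fun ℓ _ => by simp; ring)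

/-- Symplectic form on `Pauli n`. -/
def symplF (n : ℕ) : LinearMap.BilinForm (ZMod 2) (Pauli n) := sumForm n B0

/-- Symplectic form on `N` blocks of `n` qubits. -/
def symplFB (n N : ℕ) : LinearMap.BilinForm (ZMod 2) (PauliB n N) := sumForm N (symplF n)

/-- Symplectic form on the outer space `W_i`. -/
def symplFO (r N : ℕ) : LinearMap.BilinForm (ZMod 2) (Outer r N) := sumForm N (pairForm r)

/-- Orthogonal complement of a subspace w.r.t. a bilinear form. -/
def perp {M : Type*} [AddCommGroup M] [Module (ZMod 2) M]
    (B : LinearMap.BilinForm (ZMod 2) M) (S : Submodule (ZMod 2) M) :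
    Submodule (ZMod 2) M where
  carrier := {v | ∀ s ∈ S, B s v = 0}
  add_mem' := fun hu hv s hs => by
    rw [map_add, hu s hs, hv s hs, add_zero]
  zero_mem' := fun s hs => by simp
  smul_mem' := fun c v hv s hs => by
    rw [map_smul, hv s hs, smul_zero]

/-- Generic weight: number of nonzero coordinates. -/
def wgt {N : ℕ} {M : Type*} [Zero M] [DecidableEq M] (v : Fin N → M) : ℕ :=
  (Finset.univ.filter fun j => v j ≠ 0).card

/-- Symplectic weight on `N` blocks of `n` qubits: number of nonzero qubit positions. -/
def swtB {n N : ℕ} (v : PauliB n N) : ℕ := ∑ j, wgt (v j)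

/-- Stabilizer of the subcode `B_i`: `S` together with the logical `z`'s of index `< kk`. -/
def Sstab (n : ℕ) (S : Submodule (ZMod 2) (Pauli n)) (z : ℕ → Pauli n) (kk : ℕ) :
    Submodule (ZMod 2) (Pauli n) :=
  S ⊔ Submodule.span (ZMod 2) (z '' Set.Iio kk)

/-- Span of the logical operators `x_t, z_t` with `a ≤ t < b` (0-based indexing). -/
def Lspan (n : ℕ) (x z : ℕ → Pauli n) (a b : ℕ) : Submodule (ZMod 2) (Pauli n) :=
  Submodule.span (ZMod 2) ((x '' Set.Ico a b) ∪ (z '' Set.Ico a b))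

/-- The block-wise inner stabilizer `S_I`. -/
def SI (n N : ℕ) (S : Submodule (ZMod 2) (Pauli n)) : Submodule (ZMod 2) (PauliB n N) :=
  Submodule.pi (Set.univ : Set (Fin N)) (fun _ => S)

/-- The replacement map `φ` with offset `off`, sending the `ℓ`-th binary coordinates of each
block to the logical operators `x (off+ℓ)`, `z (off+ℓ)` of the inner code. -/
def phi (n N : ℕ) (x z : ℕ → Pauli n) (off r : ℕ) :
    Outer r N →ₗ[ZMod 2] PauliB n N where
  toFun w := fun j =>
    (∑ ℓ : Fin r, (w j).1 ℓ • x (off + ℓ)) + (∑ ℓ : Fin r, (w j).2 ℓ • z (off + ℓ))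
  map_add' := fun a b => by
    funext j
    simp [add_smul, Finset.sum_add_distrib]
    abel
  map_smul' := fun c a => by
    funext j
    simp [mul_smul, Finset.smul_sum, smul_add]

theorem sumForm_apply {M : Type*} [AddCommGroup M] [Module (ZMod 2) M] {N : ℕ}
    (B : LinearMap.BilinForm (ZMod 2) M) (u v : Fin N → M) :
    sumForm N B u v = ∑ j, B (u j) (v j) := rfl

theorem symplF_comm {n : ℕ} (u v : Pauli n) : symplF n u v = symplF n v u := by
  rw [symplF, sumForm_apply, sumForm_apply]
  exact Finset.sum_congr rfl fun i _ => add_comm ((u i).1 * (v i).2) ((v i).1 * (u i).2)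

/-- The coefficients of the logical operators `x_t, z_t`, `off ≤ t < off + r`, in each block. -/
def logicalPart {n N : ℕ} (x z : ℕ → Pauli n) (off r : ℕ) (v : PauliB n N) : Outer r N :=
  fun j => (fun ℓ => symplF n (z (off + ℓ)) (v j), fun ℓ => symplF n (x (off + ℓ)) (v j))

/-- Extracting logical coefficients is adjoint to the replacement map. -/
theorem symplFB_phi {n N : ℕ} (x z : ℕ → Pauli n) (off r : ℕ) (a : Outer r N)
    (v : PauliB n N) :
    symplFB n N (phi n N x z off r a) v = symplFO r N a (logicalPart x z off r v) := by
  rw [symplFB, symplFO, sumForm_apply, sumForm_apply]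
  refine Finset.sum_congr rfl fun j _ => ?_
  change symplF n ((∑ ℓ : Fin r, (a j).1 ℓ • x (off + ℓ)) + ∑ ℓ : Fin r, (a j).2 ℓ • z (off + ℓ))
      (v j) = ∑ ℓ : Fin r, ((a j).1 ℓ * symplF n (x (off + ℓ)) (v j)
        + symplF n (z (off + ℓ)) (v j) * (a j).2 ℓ)
  simp [Finset.sum_add_distrib, LinearMap.sum_apply, mul_comm]

/-- A logical operator commuting with all logical `x_t` and `z_t` is a stabilizer element. -/
theorem mem_of_logical_commute {n K : ℕ} {S : Submodule (ZMod 2) (Pauli n)} {x z : ℕ → Pauli n}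
    (hxS : ∀ t < K, x t ∈ perp (symplF n) S) (hzS : ∀ t < K, z t ∈ perp (symplF n) S)
    (hxx : ∀ s < K, ∀ t < K, symplF n (x s) (x t) = 0)
    (hzz : ∀ s < K, ∀ t < K, symplF n (z s) (z t) = 0)
    (hxz : ∀ s < K, ∀ t < K, symplF n (x s) (z t) = if s = t then 1 else 0)
    {u : Pauli n} (hu : u ∈ S ⊔ Lspan n x z 0 K)
    (hux : ∀ t < K, symplF n (x t) u = 0) (huz : ∀ t < K, symplF n (z t) u = 0) : u ∈ S := by
  let P : Pauli n →ₗ[ZMod 2] Pauli n := LinearMap.id -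
    ∑ t ∈ range K, ((symplF n (z t)).smulRight (x t) + (symplF n (x t)).smulRight (z t))
  have hP (w : Pauli n) : P w = w -
      ∑ t ∈ range K, (symplF n (z t) w • x t + symplF n (x t) w • z t) := by
    simp [P, LinearMap.sum_apply]
  have hle : S ⊔ Lspan n x z 0 K ≤ S.comap P := by
    refine sup_le (fun s hs => ?_) (Submodule.span_le.2 ?_)
    · rw [Submodule.mem_comap, hP, Finset.sum_eq_zero, sub_zero]
      · exact hs
      · intro t ht
        rw [symplF_comm _ s, symplF_comm _ s, hxS t (mem_range.1 ht) s hs,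
          hzS t (mem_range.1 ht) s hs]
        simp
    · rintro _ (⟨s, hs, rfl⟩ | ⟨s, hs, rfl⟩)
      · have hs' := hs.2
        rw [SetLike.mem_coe, Submodule.mem_comap, hP, Finset.sum_eq_single_of_mem s
          (mem_range.2 hs')]
        · simp [symplF_comm (z s), hxz s hs' s hs', hxx s hs' s hs']
        · intro t ht hts
          have ht' := mem_range.1 ht
          simp [symplF_comm (z t), hxz s hs' t ht', hxx t ht' s hs', hts.symm]
      · have hs' := hs.2
        rw [SetLike.mem_coe, Submodule.mem_comap, hP, Finset.sum_eq_single_of_mem s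
          (mem_range.2 hs')]
        · simp [hxz s hs' s hs', hzz s hs' s hs']
        · intro t ht hts
          have ht' := mem_range.1 ht
          simp [hxz t ht' s hs', hzz t ht' s hs', hts]
  have hPu : P u ∈ S := hle hu
  rwa [hP, Finset.sum_eq_zero, sub_zero] at hPu
  intro t ht
  simp [hux t (mem_range.1 ht), huz t (mem_range.1 ht)]

/-- Every index below `k 1 - k i` lies in one of the consecutive blocks before the `i`-th. -/
theorem exists_block_of_lt (k : ℕ → ℕ) {i t : ℕ} (hi : 1 ≤ i) (ht : t < k 1 - k i) :
    ∃ i', 1 ≤ i' ∧ i' < i ∧ ∃ ℓ < k i' - k (i' + 1), t = k 1 - k i' + ℓ := by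
  induction i, hi using Nat.le_induction with
  | base => omega
  | succ i hi ih =>
    by_cases h : t < k 1 - k i
    · obtain ⟨i', h1, h2, h3⟩ := ih h
      exact ⟨i', h1, by omega, h3⟩
    · exact ⟨i, hi, by omega, t - (k 1 - k i), by omega, by omega⟩

theorem logicalPart_eq_zero {n N : ℕ} {x z : ℕ → Pauli n} {off r : ℕ} {v : PauliB n N}
    (h : logicalPart x z off r v = 0) (j : Fin N) {ℓ : ℕ} (hℓ : ℓ < r) :
    symplF n (x (off + ℓ)) (v j) = 0 ∧ symplF n (z (off + ℓ)) (v j) = 0 :=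
  ⟨congrFun (congrArg Prod.snd (congrFun h j)) ⟨ℓ, hℓ⟩,
    congrFun (congrArg Prod.fst (congrFun h j)) ⟨ℓ, hℓ⟩⟩

/-- The perp of a sum with a span is tested on the generators. -/
theorem mem_perp_Sstab {n : ℕ} {S : Submodule (ZMod 2) (Pauli n)} {z : ℕ → Pauli n} {kk : ℕ}
    {u : Pauli n} (huS : u ∈ perp (symplF n) S) (huz : ∀ t < kk, symplF n (z t) u = 0) :
    u ∈ perp (symplF n) (Sstab n S z kk) := by
  have hle : Sstab n S z kk ≤ LinearMap.ker ((symplF n).flip u) :=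
    sup_le (fun s hs => huS s hs)
      (Submodule.span_le.2 (by rintro _ ⟨t, ht, rfl⟩; exact huz t ht))
  exact fun s hs => hle hs

/-- Block-wise lower bound on the symplectic weight. -/
theorem mul_wgt_le_swtB {n N d : ℕ} {M : Type*} [Zero M] [DecidableEq M] (w : Fin N → M)
    (v : PauliB n N) (h : ∀ j, w j ≠ 0 → d ≤ wgt (v j)) : d * wgt w ≤ swtB v := by
  calc d * wgt w = ∑ j ∈ univ.filter fun j => w j ≠ 0, d := by
        rw [Finset.sum_const, smul_eq_mul, mul_comm]; rfl
    _ ≤ ∑ j ∈ univ.filter fun j => w j ≠ 0, wgt (v j) :=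
        Finset.sum_le_sum fun j hj => h j (Finset.mem_filter.1 hj).2
    _ ≤ swtB v := Finset.sum_le_sum_of_subset (Finset.filter_subset _ _)

/-- Eq. (18): distance bound for a GCQC when every outer code is nondegenerate:
`swtB v ≥ min{d_1 D_1, …, d_m D_m}` for every `v ∈ S_𝒞^⊥ ∖ S_𝒞`. -/
theorem gcqc_distance_bound_nondegenerate
    (n N m : ℕ) (hm : 1 ≤ m)
    (k : ℕ → ℕ) (hk : ∀ i, 1 ≤ i → i ≤ m → k (i + 1) < k i) (hklast : k (m + 1) = 0)
    (hkn : k 1 ≤ n)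
    (S : Submodule (ZMod 2) (Pauli n))
    (hSorth : S ≤ perp (symplF n) S)
    (hSdim : Module.finrank (ZMod 2) S = n - k 1)
    (x z : ℕ → Pauli n)
    (hxS : ∀ t < k 1, x t ∈ perp (symplF n) S)
    (hzS : ∀ t < k 1, z t ∈ perp (symplF n) S)
    (hxx : ∀ s < k 1, ∀ t < k 1, symplF n (x s) (x t) = 0)
    (hzz : ∀ s < k 1, ∀ t < k 1, symplF n (z s) (z t) = 0)
    (hxz : ∀ s < k 1, ∀ t < k 1, symplF n (x s) (z t) = if s = t then 1 else 0)
    (hdual : perp (symplF n) S = S ⊔ Lspan n x z 0 (k 1))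
    (hdisj : Disjoint S (Lspan n x z 0 (k 1)))
    (d : ℕ → ℕ)
    (hd : ∀ i, 1 ≤ i → i ≤ m + 1 → ∀ v ∈ perp (symplF n) (Sstab n S z (k 1 - k i)),
      v ∉ Sstab n S z (k 1 - k i) → d i ≤ wgt v)
    (K D : ℕ → ℕ) (hKN : ∀ i, 1 ≤ i → i ≤ m → K i ≤ N)
    (SA : ∀ i : ℕ, Submodule (ZMod 2) (Outer (k i - k (i + 1)) N))
    (hSAorth : ∀ i, 1 ≤ i → i ≤ m → SA i ≤ perp (symplFO (k i - k (i + 1)) N) (SA i))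
    (hSAdim : ∀ i, 1 ≤ i → i ≤ m →
      Module.finrank (ZMod 2) (SA i) = (k i - k (i + 1)) * (N - K i))
    (hSAdist : ∀ i, 1 ≤ i → i ≤ m → ∀ w ∈ perp (symplFO (k i - k (i + 1)) N) (SA i),
      w ∉ SA i → D i ≤ wgt w)
    (SC : Submodule (ZMod 2) (PauliB n N))
    (hSC : SC = SI n N S ⊔ ⨆ i ∈ Finset.Icc 1 m,
      Submodule.map (phi n N x z (k 1 - k i) (k i - k (i + 1))) (SA i))
    (hnondeg : ∀ i, 1 ≤ i → i ≤ m → ∀ w ∈ SA i, w ≠ 0 → D i ≤ wgt w) :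
    ∀ v ∈ perp (symplFB n N) SC, v ∉ SC →
      ∀ c : ℕ, (∀ i, 1 ≤ i → i ≤ m → c ≤ d i * D i) → c ≤ swtB v := by
  intro v hv hvSC c hc
  have hSI : SI n N S ≤ SC := hSC ▸ le_sup_left
  have hvS (j : Fin N) : v j ∈ perp (symplF n) S := fun s hs => by
    have hmem : (Pi.single j s : PauliB n N) ∈ SI n N S := fun j' _ => by
      rcases eq_or_ne j' j with rfl | h
      · simpa using hs
      · simp [Pi.single_eq_of_ne h]
    have h0 := hv _ (hSI hmem)
    rw [symplFB, sumForm_apply, Finset.sum_eq_single_of_mem j (mem_univ j)] at h0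
    · simpa using h0
    · intro j' _ h
      simp [Pi.single_eq_of_ne h]
  let w (i : ℕ) : Outer (k i - k (i + 1)) N :=
    logicalPart x z (k 1 - k i) (k i - k (i + 1)) v
  have hw0 {i : ℕ} (hi : 1 ≤ i) (h : ∀ i', 1 ≤ i' → i' < i → w i' = 0) (j : Fin N) (t : ℕ)
      (ht : t < k 1 - k i) : symplF n (x t) (v j) = 0 ∧ symplF n (z t) (v j) = 0 := by
    obtain ⟨i', h1, h2, ℓ, hℓ, rfl⟩ := exists_block_of_lt k hi ht
    exact logicalPart_eq_zero (h i' h1 h2) j hℓ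
  have hex : ∃ i, 1 ≤ i ∧ i ≤ m ∧ w i ≠ 0 := by
    by_contra! h
    refine hvSC (hSI fun j _ => mem_of_logical_commute hxS hzS hxx hzz hxz (hdual ▸ hvS j) ?_ ?_)
    · exact fun t ht => (hw0 (by omega : 1 ≤ m + 1) (fun i' h1 h2 => h i' h1 (by omega)) j t
        (by omega)).1
    · exact fun t ht => (hw0 (by omega : 1 ≤ m + 1) (fun i' h1 h2 => h i' h1 (by omega)) j t
        (by omega)).2
  classical
  obtain ⟨i, ⟨hi, him, hwi⟩, hmin⟩ :
      ∃ i, (1 ≤ i ∧ i ≤ m ∧ w i ≠ 0) ∧ ∀ i', 1 ≤ i' → i' < i → w i' = 0 := by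
    refine ⟨Nat.find hex, Nat.find_spec hex, fun i' h1 h2 => ?_⟩
    by_contra h
    exact Nat.find_min hex h2 ⟨h1, h2.le.trans (Nat.find_spec hex).2.1, h⟩
  have hki : k i ≤ k 1 := by
    clear * - hk hi him
    induction i, hi using Nat.le_induction with
    | base => exact le_rfl
    | succ i hi ih => exact (hk i hi (by omega)).le.trans (ih (by omega))
  have hwperp : w i ∈ perp (symplFO (k i - k (i + 1)) N) (SA i) := fun a ha => by
    rw [← symplFB_phi]
    refine hv _ (hSC ▸ Submodule.mem_sup_right ?_)
    exact Submodule.mem_iSup_of_mem i (Submodule.mem_iSup_of_mem (Finset.mem_Icc.2 ⟨hi, him⟩)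
      (Submodule.mem_map_of_mem ha))
  have hD : D i ≤ wgt (w i) := by
    by_cases h : w i ∈ SA i
    · exact hnondeg i hi him _ h hwi
    · exact hSAdist i hi him _ hwperp h
  refine (hc i hi him).trans ((Nat.mul_le_mul_left _ hD).trans (mul_wgt_le_swtB (w i) v ?_))
  intro j hj
  refine hd i hi (by omega) _
    (mem_perp_Sstab (hvS j) fun t ht => (hw0 hi hmin j t ht).2) fun hmem => hj ?_
  have hxt (ℓ : Fin (k i - k (i + 1))) : symplF n (x (k 1 - k i + ℓ)) (v j) = 0 := by
    rw [symplF_comm]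
    refine mem_perp_Sstab (hxS _ (by omega)) (fun t ht => ?_) _ hmem
    rw [symplF_comm, hxz _ (by omega) _ (by omega), if_neg (by omega)]
  have hzt (ℓ : Fin (k i - k (i + 1))) : symplF n (z (k 1 - k i + ℓ)) (v j) = 0 := by
    rw [symplF_comm]
    exact mem_perp_Sstab (hzS _ (by omega))
      (fun t ht => hzz _ (by omega) _ (by omega)) _ hmem
  exact Prod.ext (funext hzt) (funext hxt)
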